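/- Let σ be a primitive, non-erasing, well-marked substitution over 𝔸 = {a,b} whose fixed point ξ is recurrent and not ultimately periodic, with A·B ≠ B·A and W_0, T as in the context. Then there exists L ∈ ℕ such that: (i) if W is a weak right special factor of ξ and |T(W)| ≥ L, then T(W) is a weak right special factor of ξ; and (ii) every weak right special factor W of ξ with |W| ≥ L satisfies W = T(U) for a unique weak right special factor U of ξ. -/

import Mathlib

namespace Subst

/-- `pow A m` is the `m`-fold concatenation `A^m`. -/
def pow (A : List Bool) : ℕ → List Bool
  | 0 => []
  | n + 1 => pow A n ++ A

/-- Membership in the submonoid of `𝔸*` generated by `{A, B}`. -/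
inductive GenAB (A B : List Bool) : List Bool → Prop
  | nil : GenAB A B []
  | appA : ∀ {W}, GenAB A B W → GenAB A B (W ++ A)
  | appB : ∀ {W}, GenAB A B W → GenAB A B (W ++ B)

/-- The extension of a substitution `σ : 𝔸 → 𝔸*` to a monoid morphism of `𝔸*`. -/
def subst (σ : Bool → List Bool) : List Bool → List Bool
  | [] => []
  | c :: w => σ c ++ subst σ w

/-- The factor `ξ[i, i+n)` of the infinite sequence `ξ`. -/
def wordAt (ξ : ℕ → Bool) (i n : ℕ) : List Bool :=
  (List.range n).map fun k => ξ (i + k)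

/-- `W` is a factor of the infinite sequence `ξ`. -/
def IsFactor (ξ : ℕ → Bool) (W : List Bool) : Prop :=
  ∃ i, W = wordAt ξ i W.length

/-- `ξ` is a fixed point of `σ`: for every `n`, `σ(ξ[0,n))` is a prefix of `ξ`. -/
def IsFixedPoint (σ : Bool → List Bool) (ξ : ℕ → Bool) : Prop :=
  ∀ n, subst σ (wordAt ξ 0 n) = wordAt ξ 0 (subst σ (wordAt ξ 0 n)).length

/-- `ξ` is recurrent: every factor occurs at infinitely many positions. -/
def Recurrent (ξ : ℕ → Bool) : Prop :=
  ∀ W, IsFactor ξ W → ∀ N, ∃ i, N ≤ i ∧ W = wordAt ξ i W.length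

/-- `ξ` is ultimately periodic. -/
def UltPeriodic (ξ : ℕ → Bool) : Prop :=
  ∃ p, 1 ≤ p ∧ ∃ N, ∀ n, N ≤ n → ξ (n + p) = ξ n

/-- `σ` is non-erasing: the image of each letter is nonempty. -/
def NonErasing (σ : Bool → List Bool) : Prop := ∀ c, σ c ≠ []

/-- `σ` is well-marked: `σ(c)` begins with the letter `c` for each letter `c`. -/
def WellMarked (σ : Bool → List Bool) : Prop := ∀ c, ∃ t, σ c = c :: t

/-- `σ` is primitive: for some `n ≥ 1`, each letter occurs in `σⁿ(d)` for each letter `d`. -/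
def Primitive (σ : Bool → List Bool) : Prop :=
  ∃ n, 1 ≤ n ∧ ∀ c d : Bool, c ∈ (subst σ)^[n] [d]

/-- `W` is a right special factor of `ξ`: both `Wa` and `Wb` are factors of `ξ`. -/
def RightSpecial (ξ : ℕ → Bool) (W : List Bool) : Prop :=
  ∀ c : Bool, IsFactor ξ (W ++ [c])

/-- `W` is a left special factor of `ξ`: both `aW` and `bW` are factors of `ξ`. -/
def LeftSpecial (ξ : ℕ → Bool) (W : List Bool) : Prop :=
  ∀ c : Bool, IsFactor ξ (c :: W)

/-- A right special factor is strong if all of `aWa, aWb, bWa, bWb` are factors. -/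
def StrongSpecial (ξ : ℕ → Bool) (W : List Bool) : Prop :=
  ∀ c d : Bool, IsFactor ξ (c :: (W ++ [d]))

/-- A right special factor is weak if neither `aW` nor `bW` is right special. -/
def WeakSpecial (ξ : ℕ → Bool) (W : List Bool) : Prop :=
  RightSpecial ξ W ∧ ∀ c : Bool, ¬ RightSpecial ξ (c :: W)

/-- The operator `T(W) = W₀ · σ(W)`. -/
def T (σ : Bool → List Bool) (W0 W : List Bool) : List Bool := W0 ++ subst σ W

/-- Specification of the word `W₀` (the longest common suffix of `A^∞` and `B^∞`)
together with the distinct letters `δ_a, δ_b`:  `δ_c · W₀` is a suffix of some power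
of `σ(c)` for each letter `c`, and `δ_a ≠ δ_b`. -/
def W0Spec (σ : Bool → List Bool) (W0 : List Bool) (δ : Bool → Bool) : Prop :=
  δ false ≠ δ true ∧ ∀ c, ∃ m, 1 ≤ m ∧ (δ c :: W0) <:+ pow (σ c) m

/-- The incidence matrix of `σ`: its columns are the Parikh vectors of `σ(a)` and `σ(b)`. -/
def incMat (σ : Bool → List Bool) : Matrix Bool Bool ℤ :=
  Matrix.of fun c d => ((σ d).count c : ℤ)

end Subst

namespace Subst

section Words

variable {ξ : ℕ → Bool} {σ : Bool → List Bool}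

lemma length_wordAt (ξ : ℕ → Bool) (i n : ℕ) : (wordAt ξ i n).length = n := by
  simp [wordAt]

lemma wordAt_add (ξ : ℕ → Bool) (i m n : ℕ) :
    wordAt ξ i (m + n) = wordAt ξ i m ++ wordAt ξ (i + m) n := by
  simp [wordAt, List.range_add, Function.comp_def, add_assoc]

lemma wordAt_one (ξ : ℕ → Bool) (i : ℕ) : wordAt ξ i 1 = [ξ i] := by
  simp [wordAt]

lemma wordAt_succ (ξ : ℕ → Bool) (i n : ℕ) :
    wordAt ξ i (n + 1) = wordAt ξ i n ++ [ξ (i + n)] := by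
  rw [wordAt_add, wordAt_one]

lemma wordAt_eq_iff {i j n : ℕ} :
    wordAt ξ i n = wordAt ξ j n ↔ ∀ k < n, ξ (i + k) = ξ (j + k) := by
  simp [wordAt, List.map_inj_left]

lemma eq_wordAt_of_suffix {W : List Bool} {N : ℕ} (h : W <:+ wordAt ξ 0 N) :
    W.length ≤ N ∧ W = wordAt ξ (N - W.length) W.length := by
  have hl : W.length ≤ N := by simpa [length_wordAt] using h.length_le
  refine ⟨hl, ?_⟩
  have h2 : wordAt ξ (N - W.length) W.length <:+ wordAt ξ 0 N := by
    refine ⟨wordAt ξ 0 (N - W.length), ?_⟩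
    have := wordAt_add ξ 0 (N - W.length) W.length
    rw [Nat.sub_add_cancel hl, zero_add] at this
    exact this.symm
  exact (List.suffix_of_suffix_length_le h h2 (by simp [length_wordAt])).eq_of_length
    (by simp [length_wordAt])

lemma wordAt_suffix (ξ : ℕ → Bool) (i n : ℕ) : wordAt ξ i n <:+ wordAt ξ 0 (i + n) :=
  ⟨wordAt ξ 0 i, by simpa using (wordAt_add ξ 0 i n).symm⟩

lemma isFactor_iff_suffix {W : List Bool} : IsFactor ξ W ↔ ∃ N, W <:+ wordAt ξ 0 N := by
  constructor
  · rintro ⟨i, hi⟩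
    exact ⟨i + W.length, by rw [hi, length_wordAt]; exact wordAt_suffix ξ i _⟩
  · rintro ⟨N, hN⟩
    exact ⟨_, (eq_wordAt_of_suffix hN).2⟩

lemma IsFactor.of_suffix {V W : List Bool} (hV : IsFactor ξ V) (h : W <:+ V) :
    IsFactor ξ W := by
  obtain ⟨N, hN⟩ := isFactor_iff_suffix.1 hV
  exact isFactor_iff_suffix.2 ⟨N, h.trans hN⟩

lemma concat_suffix_concat_iff {V W : List Bool} {c d : Bool} :
    W ++ [c] <:+ V ++ [d] ↔ W <:+ V ∧ c = d := by
  constructor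
  · rintro ⟨t, ht⟩
    rw [← List.append_assoc] at ht
    obtain ⟨h1, h2⟩ := List.append_inj' ht rfl
    exact ⟨⟨t, h1⟩, by simpa using h2⟩
  · rintro ⟨⟨t, rfl⟩, rfl⟩
    exact ⟨t, by simp⟩

lemma append_suffix_append_iff {U V W : List Bool} : U ++ W <:+ V ++ W ↔ U <:+ V := by
  constructor
  · rintro ⟨t, ht⟩
    rw [← List.append_assoc] at ht
    exact ⟨t, List.append_cancel_right ht⟩
  · rintro ⟨t, rfl⟩
    exact ⟨t, by simp⟩

lemma exists_suffix_of_isFactor_concat {W : List Bool} {d : Bool}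
    (h : IsFactor ξ (W ++ [d])) : ∃ N, W <:+ wordAt ξ 0 N ∧ d = ξ N := by
  obtain ⟨N, hN⟩ := isFactor_iff_suffix.1 h
  cases N with
  | zero => simp [wordAt] at hN
  | succ N =>
    rw [wordAt_succ, zero_add, concat_suffix_concat_iff] at hN
    exact ⟨N, hN⟩

lemma isFactor_concat_of_suffix {W : List Bool} {N : ℕ} (h : W <:+ wordAt ξ 0 N) :
    IsFactor ξ (W ++ [ξ N]) := by
  refine isFactor_iff_suffix.2 ⟨N + 1, ?_⟩
  rw [wordAt_succ, zero_add, concat_suffix_concat_iff]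
  exact ⟨h, rfl⟩

lemma IsFactor.exists_cons (hrec : Recurrent ξ) {W : List Bool} (h : IsFactor ξ W) :
    ∃ c, IsFactor ξ (c :: W) := by
  obtain ⟨i, hi, hW⟩ := hrec W h 1
  refine ⟨ξ (i - 1), i - 1, ?_⟩
  rw [List.length_cons, add_comm, wordAt_add, wordAt_one, Nat.sub_add_cancel hi, ← hW]
  rfl

lemma subst_append (σ : Bool → List Bool) (V W : List Bool) :
    subst σ (V ++ W) = subst σ V ++ subst σ W := by
  induction V with
  | nil => rfl
  | cons c V ih => simp [subst, ih]

lemma subst_singleton (σ : Bool → List Bool) (c : Bool) : subst σ [c] = σ c := by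
  simp [subst]

lemma subst_injective (hwm : WellMarked σ) : Function.Injective (subst σ) := by
  intro U
  induction U with
  | nil =>
    rintro (_ | ⟨c, V⟩) h
    · rfl
    · obtain ⟨t, ht⟩ := hwm c
      simp [subst, ht] at h
  | cons c U ih =>
    rintro (_ | ⟨d, V⟩) h
    · obtain ⟨t, ht⟩ := hwm c
      simp [subst, ht] at h
    · have hcd : c = d := by
        obtain ⟨t, ht⟩ := hwm c
        obtain ⟨s, hs⟩ := hwm d
        simp only [subst, ht, hs, List.cons_append, List.cons.injEq] at h
        exact h.1
      subst hcd
      rw [ih (List.append_cancel_left h)]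

lemma length_le_length_subst (hne : NonErasing σ) (W : List Bool) :
    W.length ≤ (subst σ W).length := by
  induction W with
  | nil => simp
  | cons c W ih =>
    have := List.length_pos_iff.2 (hne c)
    simp only [subst, List.length_append, List.length_cons]
    omega

/-- Two words ending in the same word, each preceded by a different letter, determine it. -/
lemma eq_of_cons_suffix {c d x y : Bool} {V W P Q : List Bool} (hcd : c ≠ d) (hxy : x ≠ y)
    (hc : c :: V <:+ P) (hd : d :: V <:+ Q) (hx : x :: W <:+ P) (hy : y :: W <:+ Q) :
    V = W := by
  have key : ∀ {c d x y : Bool} {V W : List Bool}, c ≠ d → c :: V <:+ P → d :: V <:+ Q →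
      x :: W <:+ P → y :: W <:+ Q → W.length ≤ V.length := by
    intro c d x y V W hcd hc hd hx hy
    by_contra! hlt
    have h1 : c :: V <:+ W := List.suffix_of_suffix_length_le hc
      ((List.suffix_cons x W).trans hx) (by simpa using hlt)
    have h2 : d :: V <:+ W := List.suffix_of_suffix_length_le hd
      ((List.suffix_cons y W).trans hy) (by simpa using hlt)
    have h3 := (List.suffix_of_suffix_length_le h1 h2 (by simp)).eq_of_length (by simp)
    exact hcd (List.cons.inj h3).1
  exact (List.suffix_of_suffix_length_le ((List.suffix_cons c V).trans hc)
    ((List.suffix_cons x W).trans hx) (key hxy hx hy hc hd)).eq_of_length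
    (le_antisymm (key hxy hx hy hc hd) (key hcd hc hd hx hy))

end Words

section LeftExtension

variable {σ : Bool → List Bool} {W0 : List Bool} {δ : Bool → Bool}

lemma T_append (U V : List Bool) : T σ W0 (U ++ V) = T σ W0 U ++ subst σ V := by
  simp [T, subst_append]

lemma T_concat (U : List Bool) (c : Bool) : T σ W0 (U ++ [c]) = T σ W0 U ++ σ c := by
  rw [T_append, subst_singleton]

lemma W0Spec.injective (h : W0Spec σ W0 δ) : Function.Injective δ := by
  intro x y hxy
  have := h.1
  cases x <;> cases y <;> simp_all

lemma W0Spec.exists_eq (h : W0Spec σ W0 δ) (c : Bool) : ∃ z, δ z = c :=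
  (Finite.injective_iff_surjective.1 h.injective) c

lemma W0Spec.cons_suffix_append (hne : NonErasing σ) (h : W0Spec σ W0 δ) (c : Bool) :
    δ c :: W0 <:+ W0 ++ σ c := by
  obtain ⟨m, -, hm⟩ := h.2 c
  have h1 : W0 ++ σ c <:+ pow (σ c) (m + 1) :=
    append_suffix_append_iff.2 ((List.suffix_cons _ _).trans hm)
  have h2 : ∀ m, pow (σ c) m <:+ pow (σ c) (m + 1) := by
    intro m
    induction m with
    | zero => exact List.nil_suffix
    | succ m ih => exact append_suffix_append_iff.2 ih
  have := List.length_pos_iff.2 (hne c)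
  exact List.suffix_of_suffix_length_le (hm.trans (h2 m)) h1
    (by simp only [List.length_cons, List.length_append]; omega)

lemma suffix_T (hne : NonErasing σ) (h : W0Spec σ W0 δ) (P : List Bool) :
    W0 <:+ T σ W0 P := by
  induction P using List.reverseRecOn with
  | nil => simp [T, subst]
  | append_singleton P c ih =>
    rw [T_concat]
    exact ((List.suffix_cons _ _).trans (h.cons_suffix_append hne c)).trans
      (append_suffix_append_iff.2 ih)

lemma cons_suffix_T_concat (hne : NonErasing σ) (h : W0Spec σ W0 δ) (P : List Bool)
    (c : Bool) : δ c :: W0 <:+ T σ W0 (P ++ [c]) := by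
  rw [T_concat]
  exact (h.cons_suffix_append hne c).trans (append_suffix_append_iff.2 (suffix_T hne h P))

lemma cons_T_suffix_T (hne : NonErasing σ) (h : W0Spec σ W0 δ) (P U : List Bool)
    (c : Bool) : δ c :: T σ W0 U <:+ T σ W0 (P ++ c :: U) := by
  have : P ++ c :: U = (P ++ [c]) ++ U := by simp
  rw [this, T_append]
  exact append_suffix_append_iff.2 (cons_suffix_T_concat hne h P c)

lemma exists_cons_suffix_of_cons_T_suffix (hne : NonErasing σ) (h : W0Spec σ W0 δ)
    {c : Bool} {W P : List Bool} (hs : c :: T σ W0 W <:+ T σ W0 P) :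
    ∃ z, δ z = c ∧ z :: W <:+ P := by
  induction W using List.reverseRecOn generalizing P with
  | nil =>
    rcases P.eq_nil_or_concat' with rfl | ⟨P, x, rfl⟩
    · simpa using hs.length_le
    · have h1 := cons_suffix_T_concat hne h P x
      have h2 : c :: W0 <:+ T σ W0 (P ++ [x]) := by simpa [T, subst] using hs
      have h3 := (List.suffix_of_suffix_length_le h1 h2 (by simp)).eq_of_length (by simp)
      exact ⟨x, (List.cons.inj h3).1, by simp⟩
  | append_singleton W y ih =>
    rcases P.eq_nil_or_concat' with rfl | ⟨P, x, rfl⟩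
    · have := hs.length_le
      simp only [T, subst, List.length_cons, List.length_append, List.length_nil] at this
      omega
    · have h1 := cons_suffix_T_concat hne h P x
      have h2 := (cons_suffix_T_concat hne h W y).trans ((List.suffix_cons _ _).trans hs)
      have h3 := (List.suffix_of_suffix_length_le h1 h2 (by simp)).eq_of_length (by simp)
      obtain rfl := h.injective (List.cons.inj h3).1
      rw [T_concat, T_concat, ← List.cons_append, append_suffix_append_iff] at hs
      obtain ⟨z, hz, hzP⟩ := ih hs
      exact ⟨z, hz, by rw [← List.cons_append]; exact append_suffix_append_iff.2 hzP⟩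

lemma exists_eq_T_of_cons_suffix (hne : NonErasing σ) (h : W0Spec σ W0 δ)
    {c d : Bool} (hcd : c ≠ d) {W P Q : List Bool} (hP : c :: W <:+ T σ W0 P)
    (hQ : d :: W <:+ T σ W0 Q) :
    ∃ U, W = T σ W0 U ∧ U <:+ P ∧ U <:+ Q := by
  induction P using List.reverseRecOn generalizing Q W with
  | nil =>
    have h1 : c :: W <:+ W0 := by simpa [T, subst] using hP
    have h2 := (List.suffix_of_suffix_length_le hQ (h1.trans (suffix_T hne h Q))
      (by simp)).eq_of_length (by simp)
    exact absurd (List.cons.inj h2).1.symm hcd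
  | append_singleton P x ih =>
    rcases Q.eq_nil_or_concat' with rfl | ⟨Q, y, rfl⟩
    · have h1 : d :: W <:+ W0 := by simpa [T, subst] using hQ
      have h2 := (List.suffix_of_suffix_length_le hP (h1.trans (suffix_T hne h _))
        (by simp)).eq_of_length (by simp)
      exact absurd (List.cons.inj h2).1 hcd
    · by_cases hxy : x = y
      · subst hxy
        rw [T_concat] at hP hQ
        have hle : (σ x).length ≤ W.length := by
          by_contra! hlt
          have h1 : c :: W <:+ σ x :=
            List.suffix_of_suffix_length_le hP (List.suffix_append _ _) (by simpa using hlt)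
          have h2 : d :: W <:+ σ x :=
            List.suffix_of_suffix_length_le hQ (List.suffix_append _ _) (by simpa using hlt)
          have h3 := (List.suffix_of_suffix_length_le h1 h2 (by simp)).eq_of_length (by simp)
          exact hcd (List.cons.inj h3).1
        obtain ⟨W', rfl⟩ : σ x <:+ W := List.suffix_of_suffix_length_le
          (List.suffix_append _ _) ((List.suffix_cons _ _).trans hP) hle
        rw [← List.cons_append, append_suffix_append_iff] at hP hQ
        obtain ⟨U, rfl, hUP, hUQ⟩ := ih hP hQ
        exact ⟨U ++ [x], (T_concat U x).symm, append_suffix_append_iff.2 hUP,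
          append_suffix_append_iff.2 hUQ⟩
      · refine ⟨[], ?_, List.nil_suffix, List.nil_suffix⟩
        have := eq_of_cons_suffix hcd (fun e => hxy (h.injective e)) hP hQ
          (cons_suffix_T_concat hne h P x) (cons_suffix_T_concat hne h Q y)
        simpa [T, subst] using this

end LeftExtension

section Cuts

variable {σ : Bool → List Bool} {ξ : ℕ → Bool}

/-- The position in `ξ` at which the image of the letter `ξ n` starts. -/
def cutPos (σ : Bool → List Bool) (ξ : ℕ → Bool) (n : ℕ) : ℕ :=
  (subst σ (wordAt ξ 0 n)).length

/-- `p` is a boundary of the decomposition of `ξ` into images of letters. -/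
def IsCut (σ : Bool → List Bool) (ξ : ℕ → Bool) (p : ℕ) : Prop := ∃ n, cutPos σ ξ n = p

/-- A bound for the lengths of the images of letters. -/
def maxLen (σ : Bool → List Bool) : ℕ := (σ false).length + (σ true).length

lemma length_le_maxLen (σ : Bool → List Bool) (c : Bool) : (σ c).length ≤ maxLen σ := by
  cases c <;> simp [maxLen]

lemma cutPos_zero : cutPos σ ξ 0 = 0 := by simp [cutPos, wordAt, subst]

lemma cutPos_succ (n : ℕ) : cutPos σ ξ (n + 1) = cutPos σ ξ n + (σ (ξ n)).length := by
  simp [cutPos, wordAt_succ, subst_append, subst_singleton]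

lemma subst_wordAt_zero (hfix : IsFixedPoint σ ξ) (n : ℕ) :
    subst σ (wordAt ξ 0 n) = wordAt ξ 0 (cutPos σ ξ n) := hfix n

lemma cutPos_strictMono (hne : NonErasing σ) : StrictMono (cutPos σ ξ) :=
  strictMono_nat_of_lt_succ fun n => by
    have := List.length_pos_iff.2 (hne (ξ n))
    rw [cutPos_succ]; omega

lemma subst_wordAt (hne : NonErasing σ) (hfix : IsFixedPoint σ ξ) (p t : ℕ) :
    subst σ (wordAt ξ p t) =
      wordAt ξ (cutPos σ ξ p) (cutPos σ ξ (p + t) - cutPos σ ξ p) := by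
  have hle := (cutPos_strictMono (ξ := ξ) hne).monotone (Nat.le_add_right p t)
  have h1 := subst_wordAt_zero hfix (p + t)
  rw [wordAt_add, subst_append, subst_wordAt_zero hfix p,
    ← Nat.add_sub_cancel' hle, wordAt_add] at h1
  simpa using h1

lemma image_eq_wordAt (hne : NonErasing σ) (hfix : IsFixedPoint σ ξ) (n : ℕ) :
    σ (ξ n) = wordAt ξ (cutPos σ ξ n) (σ (ξ n)).length := by
  have := subst_wordAt hne hfix n 1
  rwa [wordAt_one, subst_singleton, cutPos_succ, Nat.add_sub_cancel_left] at this

lemma apply_cutPos (hne : NonErasing σ) (hwm : WellMarked σ) (hfix : IsFixedPoint σ ξ)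
    (n : ℕ) : ξ (cutPos σ ξ n) = ξ n := by
  have h := image_eq_wordAt hne hfix n
  obtain ⟨t, ht⟩ := hwm (ξ n)
  rw [ht, List.length_cons, add_comm, wordAt_add, wordAt_one] at h
  exact (List.cons.inj h).1.symm

lemma exists_cut_block (hne : NonErasing σ) (x : ℕ) :
    ∃ n, cutPos σ ξ n ≤ x ∧ x < cutPos σ ξ (n + 1) := by
  have hmono := cutPos_strictMono (ξ := ξ) hne
  induction x with
  | zero =>
    exact ⟨0, cutPos_zero.le, by simpa [cutPos_zero] using hmono (Nat.lt_add_one 0)⟩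
  | succ x ih =>
    obtain ⟨n, h1, h2⟩ := ih
    by_cases h : x + 1 < cutPos σ ξ (n + 1)
    · exact ⟨n, by omega, h⟩
    · exact ⟨n + 1, by omega, by have := hmono (Nat.lt_add_one (n + 1)); omega⟩

/-- Past a cut, every position lies in a block starting at a cut determined by its first letter. -/
lemma IsCut.exists_block (hne : NonErasing σ) (hwm : WellMarked σ) (hfix : IsFixedPoint σ ξ)
    {x : ℕ} (hx : IsCut σ ξ x) (t : ℕ) :
    ∃ u ≤ t, IsCut σ ξ (x + u) ∧ t < u + (σ (ξ (x + u))).length := by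
  obtain ⟨m, rfl⟩ := hx
  obtain ⟨n, h1, h2⟩ := exists_cut_block (ξ := ξ) hne (cutPos σ ξ m + t)
  have hmono := cutPos_strictMono (ξ := ξ) hne
  have hmn : m ≤ n := by
    have := hmono.lt_iff_lt.1 (lt_of_le_of_lt (Nat.le_add_right _ t) h2)
    omega
  have h3 := hmono.monotone hmn
  have h4 : cutPos σ ξ m + (cutPos σ ξ n - cutPos σ ξ m) = cutPos σ ξ n := by omega
  refine ⟨cutPos σ ξ n - cutPos σ ξ m, by omega, ⟨n, h4.symm⟩, ?_⟩
  rw [h4, apply_cutPos hne hwm hfix]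
  rw [cutPos_succ] at h2
  omega

lemma IsCut.eq_of_block (hne : NonErasing σ) (hwm : WellMarked σ) (hfix : IsFixedPoint σ ξ)
    {x y : ℕ} (hx : IsCut σ ξ x) (hy : IsCut σ ξ y) (hxy : ξ x = ξ y) {k : ℕ}
    (hk : k < (σ (ξ x)).length) : ξ (x + k) = ξ (y + k) := by
  obtain ⟨m, rfl⟩ := hx
  obtain ⟨n, rfl⟩ := hy
  rw [apply_cutPos hne hwm hfix] at hxy hk
  rw [apply_cutPos hne hwm hfix] at hxy
  have h1 := image_eq_wordAt hne hfix m
  have h2 := image_eq_wordAt hne hfix n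
  rw [← hxy] at h2
  exact wordAt_eq_iff.1 (h1.symm.trans h2) k hk

lemma IsCut.add_length (hne : NonErasing σ) (hwm : WellMarked σ) (hfix : IsFixedPoint σ ξ)
    {x : ℕ} (hx : IsCut σ ξ x) : IsCut σ ξ (x + (σ (ξ x)).length) := by
  obtain ⟨m, rfl⟩ := hx
  exact ⟨m + 1, by rw [cutPos_succ, apply_cutPos hne hwm hfix]⟩

/-- Cuts propagate to the right along equal words. -/
lemma IsCut.propagate (hne : NonErasing σ) (hwm : WellMarked σ) (hfix : IsFixedPoint σ ξ)
    {x y : ℕ} (hx : IsCut σ ξ x) (hy : IsCut σ ξ y) {t : ℕ}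
    (h : ∀ u < t, ξ (x + u) = ξ (y + u)) (hxt : IsCut σ ξ (x + t)) : IsCut σ ξ (y + t) := by
  induction t using Nat.strong_induction_on with
  | _ t ih =>
    rcases Nat.eq_zero_or_pos t with rfl | ht
    · exact hy
    · obtain ⟨u, hut, hu, hlt⟩ := hx.exists_block hne hwm hfix (t - 1)
      have hyu := ih u (by omega) (fun v hv => h v (by omega)) hu
      have hle : u + (σ (ξ (x + u))).length ≤ t := by
        by_contra! hgt
        obtain ⟨m, hm⟩ := hu
        obtain ⟨n, hn⟩ := hxt
        have hmono := cutPos_strictMono (ξ := ξ) hne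
        have h1 : m < n := hmono.lt_iff_lt.1 (by omega)
        have h2 : n < m + 1 := hmono.lt_iff_lt.1 (by
          rw [cutPos_succ, ← apply_cutPos hne hwm hfix m, hm]; omega)
        omega
      have h3 := hyu.add_length hne hwm hfix
      rw [← h u (by omega)] at h3
      convert h3 using 1
      omega

lemma IsCut.of_ne (hne : NonErasing σ) (hwm : WellMarked σ) (hfix : IsFixedPoint σ ξ)
    {x y : ℕ} (hx : IsCut σ ξ x) (hy : IsCut σ ξ y) {t : ℕ}
    (h : ∀ u < t, ξ (x + u) = ξ (y + u)) (hd : ξ (x + t) ≠ ξ (y + t)) :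
    IsCut σ ξ (x + t) := by
  obtain ⟨u, hut, hu, hlt⟩ := hx.exists_block hne hwm hfix t
  rcases hut.eq_or_lt with rfl | hut'
  · exact hu
  · have hyu := hx.propagate hne hwm hfix hy (fun v hv => h v (by omega)) hu
    have := hu.eq_of_block hne hwm hfix hyu (h u hut') (k := t - u) (by omega)
    rw [add_assoc, add_assoc, Nat.add_sub_cancel' hut] at this
    exact absurd this hd

lemma cutPos_add_le (p t : ℕ) : cutPos σ ξ (p + t) ≤ cutPos σ ξ p + maxLen σ * t := by
  induction t with
  | zero => simp
  | succ t ih =>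
    have := length_le_maxLen σ (ξ (p + t))
    rw [← add_assoc, cutPos_succ, Nat.mul_succ]
    omega

lemma exists_isCut_add (hne : NonErasing σ) (x : ℕ) : ∃ d ≤ maxLen σ, IsCut σ ξ (x + d) := by
  obtain ⟨n, h1, h2⟩ := exists_cut_block (ξ := ξ) hne x
  have h3 := length_le_maxLen σ (ξ n)
  have h4 := cutPos_succ (σ := σ) (ξ := ξ) n
  exact ⟨cutPos σ ξ (n + 1) - x, by omega, n + 1, by omega⟩

end Cuts

section UniformRecurrence

variable {σ : Bool → List Bool} {ξ : ℕ → Bool}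

lemma iterate_cutPos_strictMono (hne : NonErasing σ) (m : ℕ) :
    StrictMono (cutPos σ ξ)^[m] := (cutPos_strictMono hne).iterate m

lemma iterate_cutPos_zero (m : ℕ) : (cutPos σ ξ)^[m] 0 = 0 :=
  Function.iterate_fixed cutPos_zero m

lemma iterate_subst_wordAt (hne : NonErasing σ) (hfix : IsFixedPoint σ ξ) (m p t : ℕ) :
    (subst σ)^[m] (wordAt ξ p t) =
      wordAt ξ ((cutPos σ ξ)^[m] p) ((cutPos σ ξ)^[m] (p + t) - (cutPos σ ξ)^[m] p) := by
  induction m with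
  | zero => simp
  | succ m ih =>
    have hle := (iterate_cutPos_strictMono (ξ := ξ) hne m).monotone (Nat.le_add_right p t)
    rw [Function.iterate_succ_apply', ih, subst_wordAt hne hfix, Nat.add_sub_cancel' hle]
    simp only [Function.iterate_succ_apply']

lemma iterate_cutPos_add_le (m p t : ℕ) :
    (cutPos σ ξ)^[m] (p + t) ≤ (cutPos σ ξ)^[m] p + maxLen σ ^ m * t := by
  induction m generalizing p t with
  | zero => simp
  | succ m ih =>
    obtain ⟨s, hs⟩ : ∃ s, cutPos σ ξ (p + t) ≤ cutPos σ ξ p + s ∧ s = maxLen σ * t :=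
      ⟨_, cutPos_add_le p t, rfl⟩
    simp only [Function.iterate_succ_apply]
    have hmono : Monotone (cutPos σ ξ)^[m] := by
      refine Monotone.iterate (monotone_nat_of_le_succ fun n => ?_) m
      rw [cutPos_succ]; omega
    calc _ ≤ (cutPos σ ξ)^[m] (cutPos σ ξ p + s) := hmono hs.1
      _ ≤ _ := ih _ _
      _ = _ := by rw [hs.2, pow_succ, mul_assoc]

lemma one_lt_cutPos_one (hwm : WellMarked σ) (hprim : Primitive σ) : 1 < cutPos σ ξ 1 := by
  have h1 : cutPos σ ξ 1 = (σ (ξ 0)).length := by simpa [cutPos_zero] using cutPos_succ (σ := σ) 0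
  obtain ⟨t, ht⟩ := hwm (ξ 0)
  rcases t with _ | ⟨d, t⟩
  · obtain ⟨n, -, hn⟩ := hprim
    have h2 : subst σ [ξ 0] = [ξ 0] := by rw [subst_singleton, ht]
    have h3 := hn (!(ξ 0)) (ξ 0)
    rw [Function.iterate_fixed h2] at h3
    simp at h3
  · rw [h1, ht]; simp

lemma lt_iterate_cutPos_one (hne : NonErasing σ) (hwm : WellMarked σ) (hprim : Primitive σ)
    (m : ℕ) : m < (cutPos σ ξ)^[m] 1 := by
  have hgrow : ∀ x, 1 ≤ x → x < cutPos σ ξ x := by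
    intro x hx
    induction x, hx using Nat.le_induction with
    | base => exact one_lt_cutPos_one hwm hprim
    | succ x hx ih =>
      have := cutPos_strictMono (ξ := ξ) hne (Nat.lt_add_one x)
      omega
  induction m with
  | zero => simp
  | succ m ih =>
    rw [Function.iterate_succ_apply']
    have := hgrow _ (by omega : 1 ≤ (cutPos σ ξ)^[m] 1)
    omega

lemma exists_first_ge {f : ℕ → ℕ} (h0 : f 0 = 0) (hf : StrictMono f) {K : ℕ}
    (hK : ∀ q, f (q + 1) ≤ f q + K) (x : ℕ) : ∃ q, x ≤ f q ∧ f q ≤ x + K := by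
  have hex : ∃ q, x ≤ f q := ⟨x, hf.le_apply⟩
  refine ⟨Nat.find hex, Nat.find_spec hex, ?_⟩
  rcases hq : Nat.find hex with _ | q
  · omega
  · have h1 := Nat.find_min hex (m := q) (by omega)
    have h2 := hK q
    omega

lemma uniformly_recurrent (hne : NonErasing σ) (hwm : WellMarked σ) (hprim : Primitive σ)
    (hfix : IsFixedPoint σ ξ) (l : ℕ) :
    ∃ N, ∀ x, ∃ u, x ≤ u ∧ u < x + N ∧ ∀ v < l, ξ (u + v) = ξ v := by
  obtain ⟨n, -, hn⟩ := id hprim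
  let f := (cutPos σ ξ)^[l + n]
  have hK : ∀ q, f (q + 1) ≤ f q + maxLen σ ^ (l + n) := fun q => by
    simpa using iterate_cutPos_add_le (σ := σ) (ξ := ξ) (l + n) q 1
  refine ⟨2 * maxLen σ ^ (l + n) + 1, fun x => ?_⟩
  obtain ⟨q, hq1, hq2⟩ := exists_first_ge (f := f) (iterate_cutPos_zero (l + n))
    (iterate_cutPos_strictMono hne (l + n)) hK x
  have hmem := hn (ξ 0) (ξ q)
  rw [← wordAt_one, iterate_subst_wordAt hne hfix] at hmem
  obtain ⟨k, hk, hk'⟩ := List.mem_map.1 hmem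
  rw [List.mem_range] at hk
  set p := (cutPos σ ξ)^[n] q + k with hp
  have hl := iterate_cutPos_strictMono (ξ := ξ) hne l
  have h1 : f q ≤ (cutPos σ ξ)^[l] p := by
    simp only [f, Function.iterate_add_apply]
    exact hl.monotone (by omega)
  have h2 : (cutPos σ ξ)^[l] p ≤ f (q + 1) := by
    simp only [f, Function.iterate_add_apply]
    exact hl.monotone (by omega)
  have h3 := hK q
  refine ⟨(cutPos σ ξ)^[l] p, by omega, by omega, ?_⟩
  have e1 := iterate_subst_wordAt hne hfix l p 1
  have e2 := iterate_subst_wordAt hne hfix l 0 1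
  rw [wordAt_one] at e1 e2
  rw [hk', e2] at e1
  have hlen := congrArg List.length e1
  rw [length_wordAt, length_wordAt] at hlen
  rw [← hlen, wordAt_eq_iff, iterate_cutPos_zero] at e1
  intro v hv
  have := lt_iterate_cutPos_one (ξ := ξ) hne hwm hprim l
  have := e1 v (by rw [zero_add]; omega)
  rw [zero_add] at this
  exact this.symm

lemma exists_ne_of_period (hne : NonErasing σ) (hwm : WellMarked σ) (hprim : Primitive σ)
    (hfix : IsFixedPoint σ ξ) (hnp : ¬ UltPeriodic ξ) {p : ℕ} (hp : 1 ≤ p) :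
    ∃ N, ∀ x, ∃ u < N, ξ (x + u) ≠ ξ (x + u + p) := by
  obtain ⟨n, hn⟩ : ∃ n, ξ (n + p) ≠ ξ n := by
    by_contra! h
    exact hnp ⟨p, hp, 0, fun n _ => h n⟩
  obtain ⟨N, hN⟩ := uniformly_recurrent hne hwm hprim hfix (n + p + 1)
  refine ⟨N + n, fun x => ?_⟩
  obtain ⟨u, h1, h2, h3⟩ := hN x
  refine ⟨u - x + n, by omega, ?_⟩
  have e1 : x + (u - x + n) = u + n := by omega
  rw [e1, add_assoc u n p, h3 n (by omega), h3 (n + p) (by omega)]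
  exact hn.symm

lemma exists_ne_of_bounded_period (hne : NonErasing σ) (hwm : WellMarked σ)
    (hprim : Primitive σ) (hfix : IsFixedPoint σ ξ) (hnp : ¬ UltPeriodic ξ) (Q : ℕ) :
    ∃ N, ∀ p, 1 ≤ p → p ≤ Q → ∀ x, ∃ u < N, ξ (x + u) ≠ ξ (x + u + p) := by
  induction Q with
  | zero => exact ⟨0, fun p h1 h2 => by omega⟩
  | succ Q ih =>
    obtain ⟨N, hN⟩ := ih
    obtain ⟨N', hN'⟩ := exists_ne_of_period hne hwm hprim hfix hnp (Nat.le_add_left 1 Q)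
    refine ⟨max N N', fun p h1 h2 x => ?_⟩
    rcases h2.eq_or_lt with rfl | h2
    · obtain ⟨u, hu, h⟩ := hN' x
      exact ⟨u, lt_max_of_lt_right hu, h⟩
    · obtain ⟨u, hu, h⟩ := hN p h1 (by omega) x
      exact ⟨u, lt_max_of_lt_left hu, h⟩

end UniformRecurrence

section Synchronization

variable {σ : Bool → List Bool} {ξ : ℕ → Bool}

/-- As long as two decompositions of the same word have no common cut, the overhang of one over the
other determines the continuation. -/
lemma eq_of_overhang_eq (hne : NonErasing σ) (hwm : WellMarked σ) (hfix : IsFixedPoint σ ξ)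
    {x x' y y' d N : ℕ} (hx : IsCut σ ξ x) (hx' : IsCut σ ξ x') (hy : IsCut σ ξ (y + d))
    (hy' : IsCut σ ξ (y' + d)) (hxy : ∀ u < N, ξ (x + u) = ξ (y + u))
    (hxy' : ∀ u < N, ξ (x' + u) = ξ (y' + u)) (hd : ∀ u < d, ξ (x + u) = ξ (x' + u))
    (hsync : ∀ u < N, ¬ (IsCut σ ξ (x + u) ∧ IsCut σ ξ (y + u))) :
    ∀ t < N, ξ (x + t) = ξ (x' + t) := by
  intro t
  induction t using Nat.strong_induction_on with
  | _ t ih =>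
    intro htN
    by_cases htd : t < d
    · exact hd t htd
    push Not at htd
    have hagree : ∀ u < t, ξ (x + u) = ξ (x' + u) := fun u hu => ih u hu (by omega)
    have hagree' : ∀ u < t, ξ (y + u) = ξ (y' + u) := fun u hu => by
      rw [← hxy u (by omega), ← hxy' u (by omega), hagree u hu]
    obtain ⟨u, hut, hu, hlt⟩ := hx.exists_block hne hwm hfix t
    rcases hut.lt_or_eq with hut' | rfl
    · have hu' := hx.propagate hne hwm hfix hx' (fun v hv => hagree v (by omega)) hu
      have := hu.eq_of_block hne hwm hfix hu' (hagree u hut') (k := t - u) (by omega)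
      rwa [add_assoc, add_assoc, Nat.add_sub_cancel' hut] at this
    · obtain ⟨v, hvt, hv, hlt'⟩ := hy.exists_block hne hwm hfix (u - d)
      rcases hvt.lt_or_eq with hvt' | rfl
      · have hv' := hy.propagate hne hwm hfix hy' (t := v) (fun w hw => by
          rw [add_assoc, add_assoc]; exact hagree' _ (by omega)) hv
        have := hv.eq_of_block hne hwm hfix hv'
          (by rw [add_assoc, add_assoc]; exact hagree' _ (by omega)) (k := u - d - v) (by omega)
        have e : ∀ z, z + d + v + (u - d - v) = z + u := fun z => by omega
        rw [e, e] at this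
        rw [hxy u htN, hxy' u htN, this]
      · rw [add_assoc, Nat.add_sub_cancel' htd] at hv
        exact absurd ⟨hu, hv⟩ (hsync u htN)

lemma exists_common_cut (hne : NonErasing σ) (hwm : WellMarked σ) (hprim : Primitive σ)
    (hfix : IsFixedPoint σ ξ) (hnp : ¬ UltPeriodic ξ) :
    ∃ L, ∀ i j, IsCut σ ξ i → (∀ u < L, ξ (i + u) = ξ (j + u)) →
      ∃ k ≤ L, IsCut σ ξ (i + k) ∧ IsCut σ ξ (j + k) := by
  let M := maxLen σ
  let R := Fintype.card (Fin (M + 1) × (Fin M → Bool))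
  obtain ⟨N, hN⟩ := exists_ne_of_bounded_period hne hwm hprim hfix hnp (M * R)
  refine ⟨N + M * R, fun i j hi hij => ?_⟩
  by_contra! hsync
  obtain ⟨n, rfl⟩ := hi
  have hmono := cutPos_strictMono (ξ := ξ) hne
  let o : ℕ → ℕ := fun r => cutPos σ ξ (n + r) - cutPos σ ξ n
  have ho : ∀ r, cutPos σ ξ n + o r = cutPos σ ξ (n + r) := fun r =>
    Nat.add_sub_cancel' (hmono.monotone (Nat.le_add_right n r))
  have hoR : ∀ r ≤ R, o r ≤ M * R := fun r hr => by
    have h1 := cutPos_add_le (σ := σ) (ξ := ξ) n r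
    have h2 : maxLen σ * r ≤ M * R := Nat.mul_le_mul_left _ hr
    have h3 := ho r
    omega
  choose d hdM hd using fun y => exists_isCut_add (σ := σ) (ξ := ξ) hne y
  let state : Fin (R + 1) → Fin (M + 1) × (Fin M → Bool) := fun r =>
    (⟨d (j + o r), Nat.lt_succ_of_le (hdM _)⟩, fun u => ξ (cutPos σ ξ (n + r) + u))
  obtain ⟨r, s, hne', heq⟩ := Fintype.exists_ne_map_eq_of_card_lt state (by simp [R])
  wlog hrs : r < s generalizing r s
  · exact this s r hne'.symm heq.symm (lt_of_le_of_ne (not_lt.1 hrs) hne'.symm)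
  have hdd : d (j + o r) = d (j + o s) := congrArg (fun q => (q.1 : ℕ)) heq
  have hword : ∀ u < M, ξ (cutPos σ ξ (n + r) + u) = ξ (cutPos σ ξ (n + s) + u) :=
    fun u hu => congrFun (congrArg Prod.snd heq) ⟨u, hu⟩
  have hr := hoR r (by omega)
  have hs := hoR s (by omega)
  have hor := ho r
  have hos := ho s
  have hlt : cutPos σ ξ (n + r) < cutPos σ ξ (n + s) := hmono (by simpa using hrs)
  have hagree : ∀ q : ℕ, o q ≤ M * R → ∀ u < N,
      ξ (cutPos σ ξ (n + q) + u) = ξ (j + o q + u) := fun q hq u hu => by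
    rw [← ho q, add_assoc, add_assoc]
    exact hij _ (by omega)
  have key := eq_of_overhang_eq hne hwm hfix (N := N) ⟨n + r, rfl⟩ ⟨n + s, rfl⟩
    (hd (j + o r)) (hdd ▸ hd (j + o s)) (hagree r hr) (hagree s hs)
    (fun u hu => hword u (lt_of_lt_of_le hu (hdM _)))
    (fun u hu ⟨h1, h2⟩ => hsync (o r + u) (by omega)
      (by rwa [← add_assoc, ho r]) (by rwa [← add_assoc]))
  obtain ⟨u, hu, hu'⟩ := hN (cutPos σ ξ (n + s) - cutPos σ ξ (n + r)) (by omega) (by omega)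
    (cutPos σ ξ (n + r))
  apply hu'
  rw [key u hu]
  congr 1
  omega

end Synchronization

section SpecialFactors

variable {σ : Bool → List Bool} {ξ : ℕ → Bool} {W0 : List Bool} {δ : Bool → Bool}

lemma isFactor_cons_T_concat (hne : NonErasing σ) (hwm : WellMarked σ)
    (hfix : IsFixedPoint σ ξ) (hrec : Recurrent ξ) (hW0 : W0Spec σ W0 δ) {c d : Bool}
    {U : List Bool} (h : IsFactor ξ (c :: U ++ [d])) :
    IsFactor ξ (δ c :: T σ W0 U ++ [d]) := by
  obtain ⟨i, hi, hU⟩ := hrec _ h (W0.length + 1)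
  rw [List.length_append, List.length_singleton, wordAt_succ] at hU
  obtain ⟨hcU, hd⟩ := List.append_inj' hU rfl
  obtain rfl : d = _ := by simpa using hd
  have hP : wordAt ξ 0 (i + (c :: U).length) = wordAt ξ 0 i ++ c :: U := by
    rw [wordAt_add, zero_add, ← hcU]
  have hsuf := cons_T_suffix_T hne hW0 (wordAt ξ 0 i) U c
  rw [← hP] at hsuf
  have hsuf' : δ c :: T σ W0 U <:+ subst σ (wordAt ξ 0 (i + (c :: U).length)) := by
    refine List.suffix_of_suffix_length_le hsuf (List.suffix_append _ _) ?_
    have h1 := length_le_length_subst hne (wordAt ξ 0 i)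
    rw [length_wordAt] at h1
    rw [hP, subst_append]
    simp only [T, subst, List.length_cons, List.length_append]
    omega
  rw [subst_wordAt_zero hfix] at hsuf'
  have := isFactor_concat_of_suffix hsuf'
  rwa [apply_cutPos hne hwm hfix] at this

lemma isFactor_T_concat (hne : NonErasing σ) (hwm : WellMarked σ)
    (hfix : IsFixedPoint σ ξ) (hrec : Recurrent ξ) (hW0 : W0Spec σ W0 δ) {d : Bool}
    {U : List Bool} (h : IsFactor ξ (U ++ [d])) : IsFactor ξ (T σ W0 U ++ [d]) := by
  obtain ⟨c, hc⟩ := h.exists_cons hrec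
  exact (isFactor_cons_T_concat hne hwm hfix hrec hW0 hc).of_suffix (List.suffix_cons _ _)

lemma suffix_T_wordAt_of_suffix (hfix : IsFixedPoint σ ξ) {V : List Bool} {m : ℕ}
    (h : V <:+ wordAt ξ 0 (cutPos σ ξ m)) : V <:+ T σ W0 (wordAt ξ 0 m) := by
  rw [← subst_wordAt_zero hfix] at h
  exact h.trans (List.suffix_append _ _)

lemma weakSpecial_T (hne : NonErasing σ) (hwm : WellMarked σ) (hfix : IsFixedPoint σ ξ)
    (hrec : Recurrent ξ) (hW0 : W0Spec σ W0 δ) {L : ℕ}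
    (hL : ∀ i j, IsCut σ ξ i → (∀ u < L, ξ (i + u) = ξ (j + u)) →
      ∃ k ≤ L, IsCut σ ξ (i + k) ∧ IsCut σ ξ (j + k))
    {W : List Bool} (hW : WeakSpecial ξ W) (hlen : L ≤ (subst σ W).length) :
    WeakSpecial ξ (T σ W0 W) := by
  refine ⟨fun d => isFactor_T_concat hne hwm hfix hrec hW0 (hW.1 d), fun c hc => ?_⟩
  obtain ⟨z, rfl⟩ := hW0.exists_eq c
  refine hW.2 z fun e => ?_
  obtain ⟨J, hJ, rfl⟩ := exists_suffix_of_isFactor_concat (hc e)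
  obtain ⟨n, hn⟩ := exists_suffix_of_isFactor_concat (hW.1 true)
  obtain ⟨-, hn⟩ := eq_wordAt_of_suffix hn.1
  generalize n - W.length = i at hn
  have hsub := subst_wordAt hne hfix i W.length
  rw [← hn] at hsub
  have hle := (cutPos_strictMono (ξ := ξ) hne).monotone (Nat.le_add_right i W.length)
  have hl : (subst σ W).length = cutPos σ ξ (i + W.length) - cutPos σ ξ i := by
    rw [hsub, length_wordAt]
  obtain ⟨hlJ, hJ'⟩ := eq_wordAt_of_suffix
    (((List.suffix_append W0 (subst σ W)).trans (List.suffix_cons (δ z) _)).trans hJ)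
  have hagree := wordAt_eq_iff.1 ((hl ▸ hsub).symm.trans hJ')
  obtain ⟨k, hk, hk1, hk2⟩ := hL _ _ ⟨i, rfl⟩ (fun u hu => hagree u (by omega))
  have hcut := hk1.propagate hne hwm hfix hk2 (t := (subst σ W).length - k)
    (fun u hu => by rw [add_assoc, add_assoc]; exact hagree _ (by omega))
    ⟨i + W.length, by omega⟩
  rw [add_assoc, Nat.add_sub_cancel' (by omega), Nat.sub_add_cancel hlJ] at hcut
  obtain ⟨m, rfl⟩ := hcut
  obtain ⟨y, hy, hyW⟩ := exists_cons_suffix_of_cons_T_suffix hne hW0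
    (suffix_T_wordAt_of_suffix hfix hJ)
  obtain rfl := hW0.injective hy
  rw [apply_cutPos hne hwm hfix]
  exact isFactor_concat_of_suffix hyW

lemma exists_weakSpecial_eq_T (hne : NonErasing σ) (hwm : WellMarked σ)
    (hfix : IsFixedPoint σ ξ) (hrec : Recurrent ξ) (hW0 : W0Spec σ W0 δ) {L : ℕ}
    (hL : ∀ i j, IsCut σ ξ i → (∀ u < L, ξ (i + u) = ξ (j + u)) →
      ∃ k ≤ L, IsCut σ ξ (i + k) ∧ IsCut σ ξ (j + k))
    {W : List Bool} (hW : WeakSpecial ξ W) (hlen : L + maxLen σ ≤ W.length) :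
    ∃ U, WeakSpecial ξ U ∧ W = T σ W0 U := by
  obtain ⟨c, hc⟩ := (hW.1 false).exists_cons hrec
  obtain ⟨d, hd⟩ := (hW.1 true).exists_cons hrec
  have hcd : c ≠ d := by
    rintro rfl
    exact hW.2 c (Bool.forall_bool.2 ⟨hc, hd⟩)
  obtain ⟨I, hI, hIf⟩ := exists_suffix_of_isFactor_concat (W := c :: W) hc
  obtain ⟨J, hJ, hJt⟩ := exists_suffix_of_isFactor_concat (W := d :: W) hd
  obtain ⟨hIl, hI'⟩ := eq_wordAt_of_suffix ((List.suffix_cons _ _).trans hI)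
  obtain ⟨hJl, hJ'⟩ := eq_wordAt_of_suffix ((List.suffix_cons _ _).trans hJ)
  have hagree := wordAt_eq_iff.1 (hI'.symm.trans hJ')
  obtain ⟨e, he, hcut⟩ := exists_isCut_add (σ := σ) (ξ := ξ) hne (I - W.length)
  obtain ⟨k, hk, hk1, hk2⟩ := hL _ (J - W.length + e) hcut (fun u hu => by
    rw [add_assoc, add_assoc]; exact hagree _ (by omega))
  have hagree' : ∀ u < W.length - e - k,
      ξ (I - W.length + e + k + u) = ξ (J - W.length + e + k + u) := fun u hu => by
    simp only [add_assoc]; exact hagree _ (by omega)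
  have hIe : I - W.length + e + k + (W.length - e - k) = I := by omega
  have hJe : J - W.length + e + k + (W.length - e - k) = J := by omega
  have hdiff : ξ I ≠ ξ J := by simp [← hIf, ← hJt]
  have hcI := hk1.of_ne hne hwm hfix hk2 hagree' (by rwa [hIe, hJe])
  have hcJ := hk2.of_ne hne hwm hfix hk1 (fun u hu => (hagree' u hu).symm)
    (by rw [hIe, hJe]; exact hdiff.symm)
  rw [hIe] at hcI
  rw [hJe] at hcJ
  obtain ⟨m, rfl⟩ := hcI
  obtain ⟨n, rfl⟩ := hcJ
  obtain ⟨U, rfl, hUm, hUn⟩ := exists_eq_T_of_cons_suffix hne hW0 hcd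
    (suffix_T_wordAt_of_suffix hfix hI) (suffix_T_wordAt_of_suffix hfix hJ)
  rw [apply_cutPos hne hwm hfix] at hIf hJt
  refine ⟨U, ⟨Bool.forall_bool.2 ⟨?_, ?_⟩, fun z hz => ?_⟩, rfl⟩
  · rw [hIf]; exact isFactor_concat_of_suffix hUm
  · rw [hJt]; exact isFactor_concat_of_suffix hUn
  · exact hW.2 (δ z) fun x => isFactor_cons_T_concat hne hwm hfix hrec hW0 (hz x)

end SpecialFactors

end Subst

open Subst
/-- There exists `L` such that (i) if `W` is a weak right special
factor and `|T(W)| ≥ L` then `T(W)` is a weak right special factor, and (ii) every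
weak right special factor `W` with `|W| ≥ L` equals `T(U)` for a unique weak right
special factor `U`. -/
theorem statement16 (σ : Bool → List Bool) (hne : NonErasing σ)
    (hwm : WellMarked σ) (hprim : Primitive σ)
    (hAB : σ false ++ σ true ≠ σ true ++ σ false)
    (W0 : List Bool) (δ : Bool → Bool) (hW0 : W0Spec σ W0 δ)
    (ξ : ℕ → Bool) (hfix : IsFixedPoint σ ξ) (hrec : Recurrent ξ)
    (hnp : ¬ UltPeriodic ξ) :
    ∃ L : ℕ,
      (∀ W : List Bool, WeakSpecial ξ W → L ≤ (T σ W0 W).length →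
          WeakSpecial ξ (T σ W0 W)) ∧
      (∀ W : List Bool, WeakSpecial ξ W → L ≤ W.length →
          ∃! U : List Bool, WeakSpecial ξ U ∧ W = T σ W0 U) := by
  obtain ⟨L, hL⟩ := exists_common_cut hne hwm hprim hfix hnp
  refine ⟨L + maxLen σ + W0.length, fun W hW hlen => ?_, fun W hW hlen => ?_⟩
  · refine weakSpecial_T hne hwm hfix hrec hW0 hL hW ?_
    rw [T, List.length_append] at hlen
    omega
  · obtain ⟨U, hU, rfl⟩ := exists_weakSpecial_eq_T hne hwm hfix hrec hW0 hL hW (by omega)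
    exact ⟨U, ⟨hU, rfl⟩, fun V hV =>
      (subst_injective hwm (List.append_cancel_left hV.2)).symm⟩
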